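/- Let Ω : ℝ → Matrix (Fin n) (Fin n) ℝ satisfy Ω'(t) = −γ ψ(t)ψ(t)ᵀ Ω(t) with Ω(0) = Iₙ, where γ > 0 and ψ : ℝ → ℝⁿ is continuous, and suppose ∫₀^{t_d} ψ(s)ψ(s)ᵀ ds ≥ C_d Iₙ as quadratic forms for some t_d, C_d > 0. Then for every nonzero v ∈ ℝⁿ one has |Ω(t_d)v| < |v|; i.e. Ω(t_d) is a strict contraction on every direction, and hence 1 is not an eigenvalue of Ω(t) for any t ≥ t_d. -/

import Mathlib

open Matrix

/-- Observability Gramian `W(0,T) = ∫₀ᵀ ψ(τ)ψ(τ)ᵀ dτ` (entrywise). -/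
noncomputable def obsGram (n : ℕ) (ψ : ℝ → Fin n → ℝ) (T : ℝ) :
    Matrix (Fin n) (Fin n) ℝ :=
  Matrix.of fun i j => ∫ τ in (0:ℝ)..T, ψ τ i * ψ τ j

theorem dotProduct_obsGram_mulVec {n : ℕ} {ψ : ℝ → Fin n → ℝ} (hψ : Continuous ψ) (T : ℝ)
    (v : Fin n → ℝ) :
    v ⬝ᵥ (obsGram n ψ T *ᵥ v) = ∫ τ in (0 : ℝ)..T, (ψ τ ⬝ᵥ v) ^ 2 := by
  have hc (i : Fin n) : Continuous fun τ => ψ τ i := (continuous_apply i).comp hψ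
  have hcont (i j : Fin n) : Continuous fun τ => v i * (ψ τ i * ψ τ j * v j) :=
    continuous_const.mul (((hc i).mul (hc j)).mul continuous_const)
  have hsq (τ : ℝ) : (ψ τ ⬝ᵥ v) ^ 2 = ∑ i, ∑ j, v i * (ψ τ i * ψ τ j * v j) := by
    simp only [dotProduct, sq, Finset.sum_mul_sum]
    exact Finset.sum_congr rfl fun i _ => Finset.sum_congr rfl fun j _ => by ring
  simp_rw [hsq]
  rw [intervalIntegral.integral_finsetSum fun i _ =>
    (continuous_finsetSum _ fun j _ => hcont i j).intervalIntegrable _ _]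
  simp_rw [intervalIntegral.integral_finsetSum fun j _ => (hcont _ j).intervalIntegrable _ _,
    intervalIntegral.integral_const_mul, intervalIntegral.integral_mul_const]
  simp [dotProduct, mulVec, obsGram, Finset.mul_sum]

section GradientFlow

variable {ι : Type*} [Fintype ι] {γ : ℝ} {ψ x : ℝ → ι → ℝ}

theorem hasDerivAt_dotProduct_self_of_gradientFlow
    (hx : ∀ t i, HasDerivAt (fun s => x s i) (-γ * (ψ t ⬝ᵥ x t) * ψ t i) t) (t : ℝ) :
    HasDerivAt (fun s => x s ⬝ᵥ x s) (-2 * γ * (ψ t ⬝ᵥ x t) ^ 2) t := by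
  have h := HasDerivAt.fun_sum (u := Finset.univ) fun i _ => (hx t i).mul (hx t i)
  refine h.congr_deriv ?_
  rw [sq]
  nth_rewrite 4 [dotProduct]
  rw [Finset.mul_sum, Finset.mul_sum]
  exact Finset.sum_congr rfl fun i _ => by ring

theorem antitone_dotProduct_self_of_gradientFlow (hγ : 0 ≤ γ)
    (hx : ∀ t i, HasDerivAt (fun s => x s i) (-γ * (ψ t ⬝ᵥ x t) * ψ t i) t) :
    Antitone fun t => x t ⬝ᵥ x t := by
  have h := hasDerivAt_dotProduct_self_of_gradientFlow hx
  refine antitone_of_deriv_nonpos (fun t => (h t).differentiableAt) fun t => ?_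
  rw [(h t).deriv]
  nlinarith [mul_nonneg hγ (sq_nonneg (ψ t ⬝ᵥ x t))]

theorem dotProduct_eq_zero_of_gradientFlow_of_le {T : ℝ} (hγ : 0 < γ) (hT : 0 < T)
    (hx : ∀ t i, HasDerivAt (fun s => x s i) (-γ * (ψ t ⬝ᵥ x t) * ψ t i) t)
    (hle : x 0 ⬝ᵥ x 0 ≤ x T ⬝ᵥ x T) {t : ℝ} (ht : t ∈ Set.Icc 0 T) :
    ψ t ⬝ᵥ x 0 = 0 := by
  have hanti := antitone_dotProduct_self_of_gradientFlow hγ.le hx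
  have hconst : ∀ s ∈ Set.Icc 0 T, x s ⬝ᵥ x s = x 0 ⬝ᵥ x 0 := fun s hs =>
    le_antisymm (hanti hs.1) (hle.trans (hanti hs.2))
  have horth : ∀ s ∈ Set.Icc 0 T, ψ s ⬝ᵥ x s = 0 := fun s hs => by
    have h₁ := (hasDerivAt_dotProduct_self_of_gradientFlow hx s).hasDerivWithinAt
      (s := Set.Icc 0 T)
    have h₂ : HasDerivWithinAt (fun s => x s ⬝ᵥ x s) 0 (Set.Icc 0 T) s :=
      (hasDerivWithinAt_const s _ (x 0 ⬝ᵥ x 0)).congr hconst (hconst s hs)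
    have h := (uniqueDiffOn_Icc hT s hs).eq_deriv _ h₁ h₂
    simpa [hγ.ne'] using h
  have hxt : x t = x 0 := by
    ext i
    refine constant_of_has_deriv_right_zero (f := fun s => x s i) (a := 0) (b := T)
      (fun s _ => (hx s i).continuousAt.continuousWithinAt) (fun s hs => ?_) t ht
    simpa [horth s (Set.Ico_subset_Icc_self hs)] using (hx s i).hasDerivWithinAt (s := Set.Ici s)
  rw [← hxt]
  exact horth t ht

end GradientFlow

/-- Under interval excitation `∫₀^{t_d} ψψᵀ ≥ C_d Iₙ`, the fundamental matrix
`Ω` of `Ω' = −γψψᵀΩ`, `Ω(0) = Iₙ`, is a strict contraction at `t_d` on every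
direction; hence `1` is not an eigenvalue of `Ω(t)` for any `t ≥ t_d`. -/
theorem omega_strict_contraction_of_interval_excitation (n : ℕ) (hn : 1 ≤ n)
    (γ td Cd : ℝ) (hγ : 0 < γ) (htd : 0 < td) (hCd : 0 < Cd)
    (ψ : ℝ → Fin n → ℝ) (hψ : Continuous ψ)
    (Ω : ℝ → Matrix (Fin n) (Fin n) ℝ)
    (hΩ : ∀ t, ∀ i j, HasDerivAt (fun s => Ω s i j)
        ((((-γ) • vecMulVec (ψ t) (ψ t)) * Ω t) i j) t)
    (hΩ0 : Ω 0 = 1)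
    (hIE : ∀ v : Fin n → ℝ, Cd * (v ⬝ᵥ v) ≤ v ⬝ᵥ (obsGram n ψ td *ᵥ v)) :
    (∀ v : Fin n → ℝ, v ≠ 0 →
        Real.sqrt ((Ω td *ᵥ v) ⬝ᵥ (Ω td *ᵥ v)) < Real.sqrt (v ⬝ᵥ v)) ∧
    (∀ t ≥ td, ∀ v : Fin n → ℝ, v ≠ 0 → Ω t *ᵥ v ≠ v) := by
  have hx (v : Fin n → ℝ) (t : ℝ) (i : Fin n) : HasDerivAt (fun s => (Ω s *ᵥ v) i)
      (-γ * (ψ t ⬝ᵥ (Ω t *ᵥ v)) * ψ t i) t := by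
    refine (HasDerivAt.fun_sum (u := Finset.univ)
      fun j _ => (hΩ t i j).mul_const (v j)).congr_deriv ?_
    change ((((-γ) • vecMulVec (ψ t) (ψ t)) * Ω t) *ᵥ v) i = _
    rw [← mulVec_mulVec, smul_mulVec, vecMulVec_mulVec]
    simp only [Pi.smul_apply, MulOpposite.smul_eq_mul_unop, MulOpposite.unop_op, smul_eq_mul]
    ring
  have hlt (v : Fin n → ℝ) (hv : v ≠ 0) : (Ω td *ᵥ v) ⬝ᵥ (Ω td *ᵥ v) < v ⬝ᵥ v := by
    by_contra! hle
    have horth : ∀ t ∈ Set.Icc 0 td, ψ t ⬝ᵥ v = 0 := fun t ht => by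
      simpa [hΩ0] using dotProduct_eq_zero_of_gradientFlow_of_le hγ htd (hx v)
        (by simpa [hΩ0] using hle) ht
    have hgram : v ⬝ᵥ (obsGram n ψ td *ᵥ v) = 0 := by
      rw [dotProduct_obsGram_mulVec hψ, intervalIntegral.integral_congr (g := fun _ => 0)
        fun t ht => by simp [horth t (Set.uIcc_of_le htd.le ▸ ht)]]
      simp
    have hpos : 0 < v ⬝ᵥ v := by simpa using dotProduct_star_self_pos_iff.mpr hv
    exact absurd (hIE v) (by rw [hgram]; exact not_le.mpr (mul_pos hCd hpos))
  refine ⟨fun v hv => Real.sqrt_lt_sqrt (Finset.sum_nonneg fun i _ => mul_self_nonneg _)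
    (hlt v hv), fun t ht v hv heq => ?_⟩
  have h := antitone_dotProduct_self_of_gradientFlow hγ.le (hx v) ht
  simp only [heq] at h
  exact (hlt v hv).not_ge h
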